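/- arXiv:1207.6572 — 4 statements merged into one kernel-verified Lean document; each statement's English description precedes it below -/
import Mathlib

section
/- Let A_1, …, A_m be 3×3 SR-matrices and let Ŝ = Â_1 ⊕ ⋯ ⊕ Â_m be the entrywise maximum of the normalised matrices Â_i = A_i/μ(A_i). The following are equivalent: (i) μ(Ŝ) = 1; (ii) A_i ⊗ A_j = A_j ⊗ A_i for all i, j; (iii) there exists a positive vector x ∈ int(ℝ³_+) with A_i⊗x ≤ μ(A_i)·x for all i = 1,…,m. -/
open Filter Relation

namespace MaxAlg

/-- Max-algebraic action of a matrix on a vector: `(A ⊗ x) i = max_j A i j * x j`. -/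
noncomputable def maxVec {n : ℕ} (A : Fin n → Fin n → ℝ) (x : Fin n → ℝ) : Fin n → ℝ :=
  fun i => ⨆ j, A i j * x j

/-- Max-algebraic matrix product: `(A ⊗ B) i k = max_j A i j * B j k`. -/
noncomputable def maxMul {n : ℕ} (A B : Fin n → Fin n → ℝ) : Fin n → Fin n → ℝ :=
  fun i k => ⨆ j, A i j * B j k

/-- The weight of the cycle determined by a list `[i₁, …, i_k]`,
namely `A i₁ i₂ * ⋯ * A i_{k-1} i_k * A i_k i₁`. -/
noncomputable def cycleProd {n : ℕ} (A : Fin n → Fin n → ℝ) (l : List (Fin n)) : ℝ :=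
  ((l.zip (l.rotate 1)).map fun p => A p.1 p.2).prod

/-- The maximal cycle geometric mean of `A`: the supremum over all cycles of distinct
nodes of the k-th root of the cycle weight. -/
noncomputable def mu {n : ℕ} (A : Fin n → Fin n → ℝ) : ℝ :=
  sSup {c | ∃ l : List (Fin n), l ≠ [] ∧ l.Nodup ∧ c = cycleProd A l ^ ((l.length : ℝ)⁻¹)}

/-- `C_{A,r}`: the positive vectors with `A ⊗ x ≤ r x`. -/
def Cset {n : ℕ} (A : Fin n → Fin n → ℝ) (r : ℝ) : Set (Fin n → ℝ) :=
  {x | (∀ i, 0 < x i) ∧ ∀ i, maxVec A x i ≤ r * x i}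

/-- A critical cycle: a cycle of distinct nodes attaining `mu A`. -/
def IsCriticalCycle {n : ℕ} (A : Fin n → Fin n → ℝ) (l : List (Fin n)) : Prop :=
  l ≠ [] ∧ l.Nodup ∧ cycleProd A l ^ ((l.length : ℝ)⁻¹) = mu A

/-- `(i,j) ∈ E^C(A)`: the edge `(i,j)` lies on some critical cycle. -/
def criticalEdge {n : ℕ} (A : Fin n → Fin n → ℝ) (i j : Fin n) : Prop :=
  ∃ l : List (Fin n), IsCriticalCycle A l ∧ (i, j) ∈ l.zip (l.rotate 1)

/-- `i ∈ N^C(A)`: the node `i` lies on some critical cycle. -/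
def criticalNode {n : ℕ} (A : Fin n → Fin n → ℝ) (i : Fin n) : Prop :=
  ∃ l : List (Fin n), IsCriticalCycle A l ∧ i ∈ l

/-- Irreducibility: the digraph of `A` (edge `(i,j)` iff `A i j > 0`) is strongly connected. -/
def Irred {n : ℕ} (A : Fin n → Fin n → ℝ) : Prop :=
  ∀ i j, Relation.ReflTransGen (fun a b => 0 < A a b) i j

/-- Max-algebraic product of a word of matrices from the family `A`. -/
noncomputable def wordProd {n m : ℕ} (A : Fin m → Fin n → Fin n → ℝ) :
    List (Fin m) → (Fin n → Fin n → ℝ)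
  | [] => fun i j => if i = j then 1 else 0
  | [j] => A j
  | j :: k :: w => maxMul (A j) (wordProd A (k :: w))

/-- The max version of the generalised spectral radius
`μ̂(Ψ) = limsup_{p→∞} (max_{ψ ∈ Ψ^p_⊗} μ(ψ))^{1/p}`. -/
noncomputable def genSpecRad {n m : ℕ} (A : Fin m → Fin n → Fin n → ℝ) : ℝ :=
  Filter.limsup
    (fun p : ℕ =>
      (sSup {c | ∃ w : List (Fin m), w.length = p ∧ c = mu (wordProd A w)}) ^ ((p : ℝ)⁻¹))
    Filter.atTop

/-- `S = A₁ ⊕ ⋯ ⊕ A_m`: the entrywise maximum of the family. -/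
noncomputable def Smat {n m : ℕ} (A : Fin m → Fin n → Fin n → ℝ) : Fin n → Fin n → ℝ :=
  fun i j => ⨆ k, A k i j

/-- The relative error function `e_A(x) = max_{i,j} A i j * x j / x i`. -/
noncomputable def errF {n : ℕ} (A : Fin n → Fin n → ℝ) (x : Fin n → ℝ) : ℝ :=
  ⨆ i, ⨆ j, A i j * x j / x i

/-- A symmetrically reciprocal (SR) matrix: positive, with unit diagonal and
`A i j * A j i = 1` for `i ≠ j`. -/
def IsSR {n : ℕ} (A : Fin n → Fin n → ℝ) : Prop :=
  (∀ i j, 0 < A i j) ∧ (∀ i, A i i = 1) ∧ ∀ i j, i ≠ j → A i j * A j i = 1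

/-- Max-algebraic matrix powers. -/
noncomputable def maxPow {n : ℕ} (B : Fin n → Fin n → ℝ) : ℕ → (Fin n → Fin n → ℝ)
  | 0 => fun i j => if i = j then 1 else 0
  | p + 1 => maxMul B (maxPow B p)

/-- The Kleene star `B* = I ⊕ B ⊕ B⊗² ⊕ ⋯ ⊕ B⊗^{n-1}`. -/
noncomputable def kleeneStar {n : ℕ} (B : Fin n → Fin n → ℝ) : Fin n → Fin n → ℝ :=
  fun i j => ⨆ p : Fin n, maxPow B p i j

section CycleMean

variable {n : ℕ} {A : Fin n → Fin n → ℝ}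

theorem cycleProd_nonneg (hA : ∀ i j, 0 ≤ A i j) (l : List (Fin n)) : 0 ≤ cycleProd A l := by
  refine List.prod_nonneg fun a ha => ?_
  obtain ⟨p, -, rfl⟩ := List.mem_map.1 ha
  exact hA _ _

theorem mu_le_iff (hA : ∀ i j, 0 ≤ A i j) {r : ℝ} (hr : 0 ≤ r) :
    mu A ≤ r ↔ ∀ l : List (Fin n), l ≠ [] → l.Nodup → cycleProd A l ≤ r ^ l.length := by
  have key : ∀ l : List (Fin n), l ≠ [] →
      (cycleProd A l ^ ((l.length : ℝ)⁻¹) ≤ r ↔ cycleProd A l ≤ r ^ l.length) := by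
    intro l hl
    rw [Real.rpow_inv_le_iff_of_pos (cycleProd_nonneg hA l) hr
      (by exact_mod_cast List.length_pos_iff.2 hl), Real.rpow_natCast]
  constructor
  · intro h l hl hn
    refine (key l hl).1 ((le_csSup ?_ ?_).trans h)
    swap
    · exact ⟨l, hl, hn, rfl⟩
    refine Set.Finite.bddAbove (((List.finite_length_le (Fin n) n).image
      fun l => cycleProd A l ^ ((l.length : ℝ)⁻¹)).subset ?_)
    rintro _ ⟨l, -, hn, rfl⟩
    exact ⟨l, by simpa using hn.length_le_card, rfl⟩
  · intro h
    refine Real.sSup_le ?_ hr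
    rintro _ ⟨l, hl, hn, rfl⟩
    exact (key l hl).2 (h l hl hn)

theorem mu_nonneg (hA : ∀ i j, 0 ≤ A i j) : 0 ≤ mu A := by
  refine Real.sSup_nonneg ?_
  rintro _ ⟨l, -, -, rfl⟩
  exact Real.rpow_nonneg (cycleProd_nonneg hA l) _

end CycleMean

theorem mu_le_iff_three {A : Fin 3 → Fin 3 → ℝ} (hA : ∀ i j, 0 ≤ A i j) {r : ℝ} (hr : 0 ≤ r) :
    mu A ≤ r ↔ (∀ a, A a a ≤ r) ∧ (∀ a b, a ≠ b → A a b * A b a ≤ r ^ 2) ∧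
      ∀ a b c, a ≠ b → a ≠ c → b ≠ c → A a b * A b c * A c a ≤ r ^ 3 := by
  rw [mu_le_iff hA hr]
  constructor
  · intro h
    refine ⟨fun a => ?_, fun a b hab => ?_, fun a b c hab hac hbc => ?_⟩
    · simpa [cycleProd] using h [a] (by simp) (by simp)
    · simpa [cycleProd] using h [a, b] (by simp) (by simp [hab])
    · simpa [cycleProd, mul_assoc] using h [a, b, c] (by simp) (by simp [hab, hac, hbc])
  · rintro ⟨h1, h2, h3⟩ l hl hn
    have hlen : l.length ≤ 3 := by simpa using hn.length_le_card
    match l, hl, hn, hlen with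
    | [a], _, _, _ => simpa [cycleProd] using h1 a
    | [a, b], _, hn, _ =>
      simp at hn
      simpa [cycleProd] using h2 a b hn
    | [a, b, c], _, hn, _ =>
      simp at hn
      simpa [cycleProd, mul_assoc] using h3 a b c hn.1.1 hn.1.2 hn.2
    | a :: b :: c :: d :: l, _, _, h =>
      simp only [List.length_cons] at h
      omega

theorem fin_three_cases (i j : Fin 3) : j = i ∨ j = i + 1 ∨ i = j + 1 := by
  revert i j; decide

/-- The entries of `A` on the cycle `0 → 1 → 2 → 0` are `t` after diagonal scaling by `x`. -/
def IsScaledCirculant (A : Fin 3 → Fin 3 → ℝ) (x : Fin 3 → ℝ) (t : ℝ) : Prop :=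
  ∀ i, A i (i + 1) = t * (x i / x (i + 1))

theorem maxVec_le_iff {n : ℕ} [NeZero n] {A : Fin n → Fin n → ℝ} {x : Fin n → ℝ} {i : Fin n}
    {r : ℝ} : maxVec A x i ≤ r ↔ ∀ j, A i j * x j ≤ r :=
  ciSup_le_iff (Set.finite_range _).bddAbove

namespace IsSR

variable {A : Fin 3 → Fin 3 → ℝ}

theorem succ_eq (hA : IsSR A) (i : Fin 3) : A (i + 1) i = (A i (i + 1))⁻¹ :=
  eq_inv_of_mul_eq_one_left (hA.2.2 _ _ (by revert i; decide))

theorem exists_isScaledCirculant (hA : IsSR A) :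
    ∃ (x : Fin 3 → ℝ) (t : ℝ), (∀ i, 0 < x i) ∧ 0 < t ∧ IsScaledCirculant A x t := by
  have h01 := hA.1 0 1
  have h12 := hA.1 1 2
  have h20 := hA.1 2 0
  obtain ⟨t, ht, htc⟩ : ∃ t : ℝ, 0 < t ∧ t ^ 3 = A 0 1 * A 1 2 * A 2 0 :=
    ⟨(A 0 1 * A 1 2 * A 2 0) ^ ((3 : ℕ) : ℝ)⁻¹, by positivity,
      Real.rpow_inv_natCast_pow (by positivity) (by norm_num)⟩
  refine ⟨![1, t / A 0 1, t ^ 2 / (A 0 1 * A 1 2)], t, ?_, ht, ?_⟩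
  · intro i
    fin_cases i <;> simp <;> positivity
  · intro i
    fin_cases i
    · simp
      field_simp
    · simp [show (1 : Fin 3) + 1 = 2 from rfl]
      field_simp
    · simp [show (2 : Fin 3) + 1 = 0 from rfl]
      field_simp
      linarith

theorem cycle_eq {x : Fin 3 → ℝ} {t : ℝ} (hx : ∀ i, 0 < x i)
    (h : IsScaledCirculant A x t) : A 0 1 * A 1 2 * A 2 0 = t ^ 3 := by
  have h0 := h 0
  have h1 := h 1
  have h2 := h 2
  simp only [show (0 : Fin 3) + 1 = 1 from rfl, show (1 : Fin 3) + 1 = 2 from rfl,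
    show (2 : Fin 3) + 1 = 0 from rfl] at h0 h1 h2
  have := (hx 0).ne'
  have := (hx 1).ne'
  have := (hx 2).ne'
  rw [h0, h1, h2]
  field_simp

theorem inv_cycle_eq (hA : IsSR A) {x : Fin 3 → ℝ} {t : ℝ} (hx : ∀ i, 0 < x i)
    (h : IsScaledCirculant A x t) : A 1 0 * A 0 2 * A 2 1 = t⁻¹ ^ 3 := by
  have h0 : A 1 0 = _ := hA.succ_eq 0
  have h1 : A 2 1 = _ := hA.succ_eq 1
  have h2 : A 0 2 = _ := hA.succ_eq 2
  rw [h0, h1, h2, inv_pow, ← cycle_eq hx h, mul_inv, mul_inv]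
  simp only [show (0 : Fin 3) + 1 = 1 from rfl, show (1 : Fin 3) + 1 = 2 from rfl,
    show (2 : Fin 3) + 1 = 0 from rfl]
  ring

theorem mul_le_of_isScaledCirculant (hA : IsSR A) {x : Fin 3 → ℝ} {t : ℝ} (hx : ∀ i, 0 < x i)
    (ht : 0 < t) (h : IsScaledCirculant A x t) (i j : Fin 3) :
    A i j * x j ≤ max t t⁻¹ * x i := by
  have hi := hx i
  have hj := hx j
  rcases fin_three_cases i j with rfl | rfl | rfl
  · rw [hA.2.1]
    gcongr
    rcases le_total 1 t with h1 | h1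
    · exact le_max_of_le_left h1
    · exact le_max_of_le_right ((one_le_inv₀ ht).2 h1)
  · rw [h i, mul_assoc, div_mul_cancel₀ _ hj.ne']
    gcongr
    exact le_max_left _ _
  · rw [hA.succ_eq, h j, mul_inv, inv_div, mul_assoc, div_mul_cancel₀ _ hj.ne']
    gcongr
    exact le_max_right _ _

end IsSR

/-- A positive subeigenvector for `r` bounds the maximal cycle mean by `r`. -/
theorem mu_le_of_mul_le {A : Fin 3 → Fin 3 → ℝ} (hA : ∀ i j, 0 ≤ A i j) {x : Fin 3 → ℝ}
    (hx : ∀ i, 0 < x i) {r : ℝ} (hr : 0 ≤ r) (h : ∀ i j, A i j * x j ≤ r * x i) : mu A ≤ r := by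
  have h' : ∀ i j, A i j ≤ r * (x i / x j) := fun i j => by
    rw [← mul_div_assoc, le_div_iff₀ (hx j)]
    exact h i j
  have hx' := fun i => (hx i).ne'
  have hd : ∀ i j, 0 ≤ r * (x i / x j) := fun i j =>
    mul_nonneg hr (div_pos (hx i) (hx j)).le
  rw [mu_le_iff_three hA hr]
  refine ⟨fun a => ?_, fun a b _ => ?_, fun a b c _ _ _ => ?_⟩
  · simpa [hx' a] using h' a a
  · refine (mul_le_mul (h' a b) (h' b a) (hA _ _) (hd _ _)).trans (le_of_eq ?_)
    have := hx' a
    have := hx' b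
    field_simp
  · refine (mul_le_mul (mul_le_mul (h' a b) (h' b c) (hA _ _) (hd _ _)) (h' c a) (hA _ _)
      (mul_nonneg (hd _ _) (hd _ _))).trans (le_of_eq ?_)
    have := hx' a
    have := hx' b
    have := hx' c
    field_simp

/-- A vector satisfying `l x ≤ B ⊗ x` bounds `l` by any `r` admitting a positive
subeigenvector. -/
theorem le_of_le_maxVec {n : ℕ} [NeZero n] {B : Fin n → Fin n → ℝ} (hB : ∀ i j, 0 ≤ B i j)
    {x z : Fin n → ℝ} (hx : ∀ i, 0 < x i) (hz : ∀ i, 0 < z i) {l r : ℝ}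
    (hl : ∀ i, l * x i ≤ maxVec B x i) (hr : ∀ i j, B i j * z j ≤ r * z i) : l ≤ r := by
  obtain ⟨i, hi⟩ := Finite.exists_max fun i => x i / z i
  refine le_of_mul_le_mul_right ((hl i).trans (maxVec_le_iff.2 fun j => ?_)) (hx i)
  have hj : x j ≤ x i / z i * z j := (div_le_iff₀ (hz j)).1 (hi j)
  calc B i j * x j ≤ B i j * (x i / z i * z j) := mul_le_mul_of_nonneg_left hj (hB i j)
    _ = x i / z i * (B i j * z j) := by ring
    _ ≤ x i / z i * (r * z i) := mul_le_mul_of_nonneg_left (hr i j) (div_pos (hx i) (hz i)).le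
    _ = r * x i := by
      have := (hz i).ne'
      field_simp

/-- Three positive reals bounded by `s` with product at least `s ^ 3` all equal `s`. -/
theorem eq_of_pow_three_le {a b c s : ℝ} (ha : 0 < a) (hb : 0 < b) (hc : 0 < c)
    (has : a ≤ s) (hbs : b ≤ s) (hcs : c ≤ s) (h : s ^ 3 ≤ a * b * c) :
    a = s ∧ b = s ∧ c = s := by
  have hs : 0 < s := ha.trans_le has
  have h1 : a * b * c ≤ a * s * s := by gcongr
  have h2 : a * b * c ≤ s * b * s := by gcongr
  have h3 : a * b * c ≤ s * s * c := by gcongr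
  have hss : 0 < s * s := by positivity
  refine ⟨le_antisymm has ?_, le_antisymm hbs ?_, le_antisymm hcs ?_⟩ <;>
    refine le_of_mul_le_mul_right ?_ hss <;> nlinarith

namespace IsSR

variable {A : Fin 3 → Fin 3 → ℝ}

theorem mu_eq (hA : IsSR A) {x : Fin 3 → ℝ} {t : ℝ} (hx : ∀ i, 0 < x i)
    (ht : 0 < t) (h : IsScaledCirculant A x t) : mu A = max t t⁻¹ := by
  have hA0 : ∀ i j, 0 ≤ A i j := fun i j => (hA.1 i j).le
  refine le_antisymm (mu_le_of_mul_le hA0 hx (ht.le.trans (le_max_left _ _))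
    (hA.mul_le_of_isScaledCirculant hx ht h)) ?_
  have hm := ((mu_le_iff_three hA0 (mu_nonneg hA0)).1 le_rfl).2.2
  refine max_le ?_ ?_
  · refine le_of_pow_le_pow_left₀ three_ne_zero (mu_nonneg hA0) ?_
    rw [← cycle_eq hx h]
    exact hm 0 1 2 (by decide) (by decide) (by decide)
  · refine le_of_pow_le_pow_left₀ three_ne_zero (mu_nonneg hA0) ?_
    rw [← hA.inv_cycle_eq hx h]
    exact hm 1 0 2 (by decide) (by decide) (by decide)

theorem mu_pos (hA : IsSR A) : 0 < mu A := by
  obtain ⟨x, t, hx, ht, h⟩ := hA.exists_isScaledCirculant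
  rw [hA.mu_eq hx ht h]
  exact lt_max_of_lt_left ht

/-- Every positive subeigenvector of `A` for `mu A` scales `A` to a circulant matrix. -/
theorem isScaledCirculant_of_mul_le (hA : IsSR A) {x y : Fin 3 → ℝ} {t : ℝ}
    (hx : ∀ i, 0 < x i) (ht : 0 < t) (h : IsScaledCirculant A x t) (hy : ∀ i, 0 < y i)
    (hAy : ∀ i j, A i j * y j ≤ mu A * y i) : IsScaledCirculant A y t := by
  have hmu := hA.mu_eq hx ht h
  have hb : ∀ i j, A i j * y j / y i ≤ mu A := fun i j => (div_le_iff₀ (hy i)).2 (hAy i j)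
  have hpos : ∀ i j, 0 < A i j * y j / y i := fun i j =>
    div_pos (mul_pos (hA.1 i j) (hy j)) (hy i)
  have := (hy 0).ne'
  have := (hy 1).ne'
  have := (hy 2).ne'
  have hcyc := cycle_eq hx h
  have hinv := hA.inv_cycle_eq hx h
  rcases le_total t⁻¹ t with htt | htt
  · rw [max_eq_left htt] at hmu
    obtain ⟨h0, h1, h2⟩ := eq_of_pow_three_le (hpos 0 1) (hpos 1 2) (hpos 2 0)
      (hb 0 1) (hb 1 2) (hb 2 0) (by rw [hmu, ← hcyc]; apply le_of_eq; field_simp)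
    have key : ∀ i, A i (i + 1) * y (i + 1) / y i = t := by
      intro i
      rw [← hmu]
      fin_cases i <;> assumption
    intro i
    have := (hy i).ne'
    have := (hy (i + 1)).ne'
    rw [← key i]
    field_simp
  · rw [max_eq_right htt] at hmu
    obtain ⟨h0, h1, h2⟩ := eq_of_pow_three_le (hpos 1 0) (hpos 0 2) (hpos 2 1)
      (hb 1 0) (hb 0 2) (hb 2 1) (by rw [hmu, ← hinv]; apply le_of_eq; field_simp)
    have key : ∀ i, A (i + 1) i * y i / y (i + 1) = t⁻¹ := by
      intro i
      rw [← hmu]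
      fin_cases i <;> assumption
    intro i
    have := (hy i).ne'
    have := (hy (i + 1)).ne'
    have := (hA.1 i (i + 1)).ne'
    have hk := key i
    rw [hA.succ_eq] at hk
    rw [← inv_inv t, ← hk]
    field_simp

/-- Entries of a diagonally scaled circulant matrix depend only on the index difference,
up to the scaling. -/
theorem exists_eq_mul_div (hA : IsSR A) {x : Fin 3 → ℝ} {t : ℝ} (hx : ∀ i, 0 < x i)
    (h : IsScaledCirculant A x t) :
    ∃ f : Fin 3 → ℝ, ∀ i j, A i j = f (j - i) * (x i / x j) := by
  refine ⟨![1, t, t⁻¹], fun i j => ?_⟩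
  rcases fin_three_cases i j with rfl | rfl | rfl
  · simp [hA.2.1, (hx _).ne']
  · simp [h i]
  · have hd : j - (j + 1) = 2 := by revert j; decide
    rw [hA.succ_eq, h j, hd, mul_inv, inv_div]
    rfl

end IsSR

theorem maxMul_comm_of_eq_mul_div {n : ℕ} [NeZero n] {A B : Fin n → Fin n → ℝ}
    {x f g : Fin n → ℝ} (hx : ∀ i, 0 < x i) (hA : ∀ i j, A i j = f (j - i) * (x i / x j))
    (hB : ∀ i j, B i j = g (j - i) * (x i / x j)) : maxMul A B = maxMul B A := by
  funext i k
  refine (Equiv.subLeft (i + k)).iSup_congr fun j => ?_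
  have := (hx j).ne'
  have := (hx (i + k - j)).ne'
  rw [Equiv.subLeft_apply, hA, hB, hA, hB, show i + k - j - i = k - j by abel,
    show k - (i + k - j) = j - i by abel]
  field_simp

theorem maxVec_maxMul {n : ℕ} [NeZero n] {A B : Fin n → Fin n → ℝ} {x : Fin n → ℝ}
    (hA : ∀ i j, 0 ≤ A i j) (hx : ∀ i, 0 ≤ x i) :
    maxVec (maxMul A B) x = maxVec A (maxVec B x) := by
  funext i
  simp only [maxVec, maxMul, Real.iSup_mul_of_nonneg (hx _), Real.mul_iSup_of_nonneg (hA _ _)]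
  have hfin : ∀ f : Fin n → ℝ, BddAbove (Set.range f) := fun f => (Set.finite_range f).bddAbove
  refine le_antisymm (ciSup_le fun k => ciSup_le fun j => ?_)
    (ciSup_le fun j => ciSup_le fun k => ?_)
  · rw [mul_assoc]
    exact (le_ciSup (hfin fun k => A i j * (B j k * x k)) k).trans
      (le_ciSup (hfin fun j => ⨆ k, A i j * (B j k * x k)) j)
  · rw [← mul_assoc]
    exact (le_ciSup (hfin fun j => A i j * B j k * x k) j).trans
      (le_ciSup (hfin fun k => ⨆ j, A i j * B j k * x k) k)

theorem maxVec_pos {n : ℕ} [NeZero n] {A : Fin n → Fin n → ℝ} {x : Fin n → ℝ}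
    (hA : ∀ i j, 0 < A i j) (hx : ∀ i, 0 < x i) (i : Fin n) : 0 < maxVec A x i :=
  (mul_pos (hA i 0) (hx 0)).trans_le
    (le_ciSup (f := fun j => A i j * x j) (Set.finite_range _).bddAbove 0)

namespace IsSR

/-- A matrix commuting with an SR-matrix `A` shares the positive eigenvector of `A`. -/
theorem mul_le_of_maxMul_comm {A B : Fin 3 → Fin 3 → ℝ} (hA : IsSR A) (hB : IsSR B)
    {x : Fin 3 → ℝ} {t : ℝ} (hx : ∀ i, 0 < x i) (ht : 0 < t) (h : IsScaledCirculant A x t)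
    (hAB : maxMul A B = maxMul B A) (i j : Fin 3) : B i j * x j ≤ mu B * x i := by
  set w := maxVec B x with hw
  have hwpos : ∀ i, 0 < w i := maxVec_pos hB.1 hx
  have hAx : ∀ i, maxVec A x i ≤ mu A * x i := fun i => by
    rw [hA.mu_eq hx ht h]
    exact maxVec_le_iff.2 (hA.mul_le_of_isScaledCirculant hx ht h i)
  have hAw : ∀ i, maxVec A w i ≤ mu A * w i := by
    intro i
    rw [hw, ← maxVec_maxMul (fun i j => (hA.1 i j).le) (fun i => (hx i).le), hAB,
      maxVec_maxMul (fun i j => (hB.1 i j).le) (fun i => (hx i).le), maxVec_le_iff]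
    intro j
    calc B i j * maxVec A x j ≤ B i j * (mu A * x j) :=
          mul_le_mul_of_nonneg_left (hAx j) (hB.1 i j).le
      _ = mu A * (B i j * x j) := by ring
      _ ≤ mu A * maxVec B x i :=
          mul_le_mul_of_nonneg_left (maxVec_le_iff.1 le_rfl j) hA.mu_pos.le
  have hcirc := hA.isScaledCirculant_of_mul_le hx ht h hwpos fun i j => maxVec_le_iff.1 (hAw i) j
  have hstep : ∀ i, w (i + 1) / x (i + 1) = w i / x i := by
    intro i
    have h1 : t * (x i / x (i + 1)) = t * (w i / w (i + 1)) := (h i).symm.trans (hcirc i)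
    have h2 := mul_left_cancel₀ ht.ne' h1
    rw [div_eq_div_iff (hx _).ne' (hwpos _).ne'] at h2
    rw [div_eq_div_iff (hx _).ne' (hx _).ne']
    linarith
  have hratio : ∀ i, w i = w 0 / x 0 * x i := by
    intro i
    rw [← div_eq_iff (hx i).ne']
    have h0 := hstep 0
    have h1 := hstep 1
    fin_cases i
    · rfl
    · exact h0
    · exact h1.trans h0
  obtain ⟨z, s, hz, hs, hBz⟩ := hB.exists_isScaledCirculant
  have hle : w 0 / x 0 ≤ mu B := by
    refine le_of_le_maxVec (fun i j => (hB.1 i j).le) hx hz (fun i => (hratio i).ge) ?_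
    rw [hB.mu_eq hz hs hBz]
    exact hB.mul_le_of_isScaledCirculant hz hs hBz
  calc B i j * x j ≤ w i := maxVec_le_iff.1 le_rfl j
    _ = w 0 / x 0 * x i := hratio i
    _ ≤ mu B * x i := mul_le_mul_of_nonneg_right hle (hx i).le

/-- If `S` dominates the normalisation of an SR-matrix `A` and has cycle mean at most one,
then the eigenvector of `A` is a subeigenvector of `S`. -/
theorem mul_le_of_div_mu_le {A S : Fin 3 → Fin 3 → ℝ} (hA : IsSR A) {x : Fin 3 → ℝ} {t : ℝ}
    (hx : ∀ i, 0 < x i) (ht : 0 < t) (h : IsScaledCirculant A x t)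
    (hAS : ∀ i j, A i j / mu A ≤ S i j) (hS : mu S ≤ 1) (i j : Fin 3) : S i j * x j ≤ x i := by
  have hpos : ∀ i j, 0 < S i j := fun i j => (div_pos (hA.1 i j) hA.mu_pos).trans_le (hAS i j)
  obtain ⟨h1, h2, h3⟩ := (mu_le_iff_three (fun i j => (hpos i j).le) zero_le_one).1 hS
  simp only [one_pow] at h2 h3
  have hmu := hA.mu_eq hx ht h
  have hp : ∀ i j, 0 < S i j * x j / x i := fun i j => div_pos (mul_pos (hpos i j) (hx j)) (hx i)
  have h2' : ∀ i j, i ≠ j → (S i j * x j / x i) * (S j i * x i / x j) ≤ 1 := by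
    intro i j hij
    refine le_trans (le_of_eq ?_) (h2 i j hij)
    have := (hx i).ne'
    have := (hx j).ne'
    field_simp
  have h3' : ∀ i j k, i ≠ j → i ≠ k → j ≠ k →
      (S i j * x j / x i) * (S j k * x k / x j) * (S k i * x i / x k) ≤ 1 := by
    intro i j k hij hik hjk
    refine le_trans (le_of_eq ?_) (h3 i j k hij hik hjk)
    have := (hx i).ne'
    have := (hx j).ne'
    have := (hx k).ne'
    field_simp
  have hge : (∀ i, 1 ≤ S i (i + 1) * x (i + 1) / x i) ∨
      ∀ i, 1 ≤ S (i + 1) i * x i / x (i + 1) := by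
    have hS' : ∀ i j, A i j * x j = mu A * x i → 1 ≤ S i j * x j / x i := by
      intro i j hij
      rw [le_div_iff₀ (hx i), one_mul]
      calc x i = A i j / mu A * x j := by
            rw [div_mul_eq_mul_div, hij, mul_div_cancel_left₀ _ hA.mu_pos.ne']
        _ ≤ S i j * x j := mul_le_mul_of_nonneg_right (hAS i j) (hx j).le
    rcases le_total t⁻¹ t with htt | htt
    · refine Or.inl fun i => hS' _ _ ?_
      rw [hmu, max_eq_left htt, h i, mul_assoc, div_mul_cancel₀ _ (hx _).ne']
    · refine Or.inr fun i => hS' _ _ ?_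
      rw [hmu, max_eq_right htt, hA.succ_eq, h i, mul_inv, inv_div, mul_assoc,
        div_mul_cancel₀ _ (hx _).ne']
  have hne : ∀ i : Fin 3, i ≠ i + 1 ∧ i ≠ i + 1 + 1 ∧ i + 1 + 1 + 1 = i := by decide
  suffices S i j * x j / x i ≤ 1 by
    rwa [div_le_one (hx i)] at this
  have hone : ∀ {a b c : ℝ}, 0 < a → 1 ≤ b → 1 ≤ c → a * b * c ≤ 1 → a ≤ 1 := by
    intro a b c ha hb hc habc
    refine le_trans ?_ habc
    rw [mul_assoc]
    exact le_mul_of_one_le_right ha.le (one_le_mul_of_one_le_of_one_le hb hc)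
  have hone' : ∀ {a b : ℝ}, 0 < a → 1 ≤ b → a * b ≤ 1 → a ≤ 1 := fun ha hb hab =>
    hone ha hb le_rfl (by rwa [mul_one])
  rcases fin_three_cases i j with rfl | rfl | rfl
  · rw [mul_div_assoc, div_self (hx _).ne', mul_one]
    exact h1 _
  · obtain ⟨n1, n2, n3⟩ := hne i
    rcases hge with hge | hge
    · have := hge (i + 1 + 1)
      rw [n3] at this
      exact hone (hp _ _) (hge _) this (h3' i (i + 1) (i + 1 + 1) n1 n2 (hne _).1)
    · exact hone' (hp _ _) (hge i) (h2' _ _ n1)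
  · obtain ⟨n1, n2, n3⟩ := hne j
    rcases hge with hge | hge
    · exact hone' (hp _ _) (hge j) (h2' _ _ n1.symm)
    · have := hge (j + 1 + 1)
      rw [n3] at this
      exact hone (hp _ _) this (hge (j + 1)) (h3' (j + 1) j (j + 1 + 1) n1.symm (hne _).1 n2)

/-- A matrix dominating the normalisation of an SR-matrix has cycle mean at least one. -/
theorem one_le_mu_of_div_mu_le {A S : Fin 3 → Fin 3 → ℝ} (hA : IsSR A)
    (hAS : ∀ i j, A i j / mu A ≤ S i j) : 1 ≤ mu S := by
  have hM := hA.mu_pos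
  have hpos : ∀ i j, 0 ≤ A i j / mu A := fun i j => (div_pos (hA.1 i j) hM).le
  have hS : ∀ i j, 0 ≤ S i j := fun i j => (hpos i j).trans (hAS i j)
  suffices mu A ≤ mu S * mu A from le_of_mul_le_mul_right (by rwa [one_mul]) hM
  have hAS' : ∀ i j, A i j ≤ S i j * mu A := fun i j => (div_le_iff₀ hM).1 (hAS i j)
  have hA0 : ∀ i j, 0 ≤ A i j := fun i j => (hA.1 i j).le
  have hSA : ∀ i j, 0 ≤ S i j * mu A := fun i j => (hA0 i j).trans (hAS' i j)
  obtain ⟨h1, h2, h3⟩ := (mu_le_iff_three hS (mu_nonneg hS)).1 le_rfl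
  rw [mu_le_iff_three hA0 (mul_nonneg (mu_nonneg hS) hM.le)]
  refine ⟨fun a => ?_, fun a b hab => ?_, fun a b c hab hac hbc => ?_⟩
  · exact (hAS' a a).trans (mul_le_mul_of_nonneg_right (h1 a) hM.le)
  · calc A a b * A b a ≤ (S a b * mu A) * (S b a * mu A) :=
          mul_le_mul (hAS' _ _) (hAS' _ _) (hA0 _ _) (hSA _ _)
      _ = (S a b * S b a) * mu A ^ 2 := by ring
      _ ≤ mu S ^ 2 * mu A ^ 2 := mul_le_mul_of_nonneg_right (h2 a b hab) (by positivity)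
      _ = (mu S * mu A) ^ 2 := by ring
  · calc A a b * A b c * A c a ≤ (S a b * mu A) * (S b c * mu A) * (S c a * mu A) :=
          mul_le_mul (mul_le_mul (hAS' _ _) (hAS' _ _) (hA0 _ _) (hSA _ _)) (hAS' _ _)
            (hA0 _ _) (mul_nonneg (hSA _ _) (hSA _ _))
      _ = (S a b * S b c * S c a) * mu A ^ 3 := by ring
      _ ≤ mu S ^ 3 * mu A ^ 3 :=
          mul_le_mul_of_nonneg_right (h3 a b c hab hac hbc) (by positivity)
      _ = (mu S * mu A) ^ 3 := by ring

end IsSR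

/-- for a finite family of `3 × 3` SR-matrices with
`Ŝ = Â₁ ⊕ ⋯ ⊕ Â_m`, the following are equivalent: (i) `μ(Ŝ) = 1`;
(ii) the matrices pairwise commute max-algebraically; (iii) they have a common
positive subeigenvector. -/
theorem stmt13 {m : ℕ} (hm : 0 < m) (A : Fin m → Fin 3 → Fin 3 → ℝ)
    (hSR : ∀ k, IsSR (A k)) :
    List.TFAE [
      mu (fun i j => ⨆ k, A k i j / mu (A k)) = 1,
      ∀ k l, maxMul (A k) (A l) = maxMul (A l) (A k),
      ∃ x : Fin 3 → ℝ, (∀ i, 0 < x i) ∧ ∀ k i, maxVec (A k) x i ≤ mu (A k) * x i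
    ] := by
  have : Nonempty (Fin m) := ⟨⟨0, hm⟩⟩
  let k₀ : Fin m := ⟨0, hm⟩
  have hS : ∀ k i j, A k i j / mu (A k) ≤ ⨆ k, A k i j / mu (A k) := fun k i j =>
    le_ciSup (f := fun k => A k i j / mu (A k)) (Set.finite_range _).bddAbove k
  obtain ⟨x, t, hx, ht, h⟩ := (hSR k₀).exists_isScaledCirculant
  tfae_have 1 → 3 := by
    refine fun hmu => ⟨x, hx, fun k i => maxVec_le_iff.2 fun j => ?_⟩
    have hj := (hSR k₀).mul_le_of_div_mu_le hx ht h (hS k₀) hmu.le i j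
    have hk := (mul_le_mul_of_nonneg_right (hS k i j) (hx j).le).trans hj
    rwa [div_mul_eq_mul_div, div_le_iff₀ (hSR k).mu_pos, mul_comm (x i)] at hk
  tfae_have 3 → 1 := by
    rintro ⟨y, hy, hAy⟩
    refine le_antisymm (mu_le_of_mul_le (fun i j => ?_) hy zero_le_one fun i j => ?_)
      ((hSR k₀).one_le_mu_of_div_mu_le (hS k₀))
    · exact (div_pos ((hSR k₀).1 i j) (hSR k₀).mu_pos).le.trans (hS k₀ i j)
    · rw [one_mul, ← le_div_iff₀ (hy j)]
      refine ciSup_le fun k => ?_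
      rw [div_le_div_iff₀ (hSR k).mu_pos (hy j), mul_comm (y i)]
      exact maxVec_le_iff.1 (hAy k i) j
  tfae_have 3 → 2 := by
    rintro ⟨y, hy, hAy⟩ k l
    have key : ∀ k, ∃ f : Fin 3 → ℝ, ∀ i j, A k i j = f (j - i) * (y i / y j) := by
      intro k
      obtain ⟨z, s, hz, hs, hAz⟩ := (hSR k).exists_isScaledCirculant
      exact (hSR k).exists_eq_mul_div hy <| (hSR k).isScaledCirculant_of_mul_le hz hs hAz hy
        fun i j => maxVec_le_iff.1 (hAy k i) j
    obtain ⟨f, hf⟩ := key k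
    obtain ⟨g, hg⟩ := key l
    exact maxMul_comm_of_eq_mul_div hy hf hg
  tfae_have 2 → 3 := fun hcomm => ⟨x, hx, fun k i => maxVec_le_iff.2
    ((hSR k₀).mul_le_of_maxMul_comm (hSR k) hx ht h (hcomm k₀ k) i)⟩
  tfae_finish


end MaxAlg
end

section
/- Let Ψ = {A_1, …, A_m} be a finite set of nonnegative n×n matrices, at least one of which is nonzero, with μ̂(Ψ) > 0. Then: (i) the quantity min_{x ∈ int(ℝ^n_+)} max_{1≤i≤m} e_{A_i}(x) is attained and equals μ̂(Ψ); and (ii) a positive vector x attains this minimum if and only if x ∈ C_Ψ = C_{Ψ,μ̂(Ψ)}. -/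
open Filter Relation

namespace MaxAlg

section EntrywiseBounds

variable {n m : ℕ}

theorem cycleProd_le {P : Fin n → Fin n → ℝ} {x : Fin n → ℝ} {R : ℝ}
    (hP : ∀ i j, 0 ≤ P i j) (hx : ∀ i, 0 < x i) (h : ∀ i j, P i j * x j ≤ R * x i)
    (l : List (Fin n)) : cycleProd P l ≤ R ^ l.length := by
  have hle : cycleProd P l ≤
      ((l.zip (l.rotate 1)).map fun p => R * x p.1 * (x p.2)⁻¹).prod := by
    refine List.prod_map_le_prod_map₀ _ _ (fun p _ => hP _ _) fun p _ => ?_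
    rw [← div_eq_mul_inv, le_div_iff₀ (hx _)]
    exact h _ _
  refine hle.trans (le_of_eq ?_)
  have hfst : ((l.zip (l.rotate 1)).map fun p => x p.1) = l.map x := by
    rw [← Function.comp_def x Prod.fst, ← List.map_map, List.map_fst_zip (by simp)]
  have hsnd : ((l.zip (l.rotate 1)).map fun p => (x p.2)⁻¹) =
      (l.rotate 1).map fun i => (x i)⁻¹ := by
    rw [← Function.comp_def (fun i => (x i)⁻¹) Prod.snd, ← List.map_map,
      List.map_snd_zip (by simp)]
  rw [List.prod_map_mul, List.prod_map_mul, hfst, hsnd,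
    (((List.rotate_perm l 1).map fun i => (x i)⁻¹).prod_eq), mul_assoc, ← List.prod_map_mul]
  simp [mul_inv_cancel₀ (hx _).ne']

theorem cycleMean_le {P : Fin n → Fin n → ℝ} {x : Fin n → ℝ} {R : ℝ} (hR : 0 ≤ R)
    (hP : ∀ i j, 0 ≤ P i j) (hx : ∀ i, 0 < x i) (h : ∀ i j, P i j * x j ≤ R * x i)
    {l : List (Fin n)} (hl : l ≠ []) :
    cycleProd P l ^ ((l.length : ℝ)⁻¹) ≤ R := by
  have hprod : 0 ≤ cycleProd P l :=
    List.prod_nonneg fun a ha => by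
      obtain ⟨p, -, rfl⟩ := List.mem_map.1 ha
      exact hP _ _
  calc cycleProd P l ^ ((l.length : ℝ)⁻¹) ≤ (R ^ l.length) ^ ((l.length : ℝ)⁻¹) :=
        Real.rpow_le_rpow hprod (cycleProd_le hP hx h l) (by positivity)
    _ = R := Real.pow_rpow_inv_natCast hR (by simpa using hl)

theorem mu_le {P : Fin n → Fin n → ℝ} {x : Fin n → ℝ} {R : ℝ} (hR : 0 ≤ R)
    (hP : ∀ i j, 0 ≤ P i j) (hx : ∀ i, 0 < x i) (h : ∀ i j, P i j * x j ≤ R * x i) :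
    mu P ≤ R := by
  refine Real.sSup_le ?_ hR
  rintro _ ⟨l, hl, -, rfl⟩
  exact cycleMean_le hR hP hx h hl

theorem diag_le_mu {P : Fin n → Fin n → ℝ} {x : Fin n → ℝ} {R : ℝ} (hR : 0 ≤ R)
    (hP : ∀ i j, 0 ≤ P i j) (hx : ∀ i, 0 < x i) (h : ∀ i j, P i j * x j ≤ R * x i)
    (i : Fin n) : P i i ≤ mu P := by
  refine le_csSup ⟨R, ?_⟩ ⟨[i], by simp, by simp, by simp [cycleProd]⟩
  rintro _ ⟨l, hl, -, rfl⟩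
  exact cycleMean_le hR hP hx h hl

theorem mu_nonneg_s14 {P : Fin n → Fin n → ℝ} (hP : ∀ i j, 0 ≤ P i j) : 0 ≤ mu P := by
  refine Real.sSup_nonneg ?_
  rintro _ ⟨l, -, -, rfl⟩
  refine Real.rpow_nonneg (List.prod_nonneg fun a ha => ?_) _
  obtain ⟨p, -, rfl⟩ := List.mem_map.1 ha
  exact hP _ _

theorem wordProd_nonneg {A : Fin m → Fin n → Fin n → ℝ} (hA : ∀ k i j, 0 ≤ A k i j) :
    ∀ (w : List (Fin m)) (i j : Fin n), 0 ≤ wordProd A w i j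
  | [], i, j => by
    simp only [wordProd]
    split_ifs <;> norm_num
  | [k], i, j => hA k i j
  | k :: k' :: w, i, j =>
    Real.iSup_nonneg fun u => mul_nonneg (hA _ _ _) (wordProd_nonneg hA (k' :: w) u j)

theorem wordProd_mul_le {A : Fin m → Fin n → Fin n → ℝ} {x : Fin n → ℝ} {r : ℝ} (hr : 0 ≤ r)
    (hA : ∀ k i j, 0 ≤ A k i j) (hx : ∀ i, 0 < x i)
    (h : ∀ k i j, A k i j * x j ≤ r * x i) :
    ∀ (w : List (Fin m)) (i j : Fin n), wordProd A w i j * x j ≤ r ^ w.length * x i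
  | [], i, j => by
    by_cases hij : i = j
    · simp [wordProd, hij]
    · simp [wordProd, hij, (hx i).le]
  | [k], i, j => by simpa [wordProd] using h k i j
  | k :: k' :: w, i, j => by
    have ih := fun u => wordProd_mul_le hr hA hx h (k' :: w) u j
    simp only [wordProd, maxMul]
    rw [← le_div_iff₀ (hx j)]
    refine Real.iSup_le (fun u => ?_) ?_
    · rw [le_div_iff₀ (hx j), mul_assoc]
      calc A k i u * (wordProd A (k' :: w) u j * x j)
          ≤ A k i u * (r ^ (k' :: w).length * x u) :=
            mul_le_mul_of_nonneg_left (ih u) (hA _ _ _)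
        _ = r ^ (k' :: w).length * (A k i u * x u) := by ring
        _ ≤ r ^ (k' :: w).length * (r * x i) :=
            mul_le_mul_of_nonneg_left (h _ _ _) (by positivity)
        _ = r ^ (k :: k' :: w).length * x i := by
            rw [List.length_cons (a := k), pow_succ]
            ring
    · have := (hx i).le
      have := (hx j).le
      positivity

theorem mul_wordProd_le_wordProd_cons {A : Fin m → Fin n → Fin n → ℝ}
    (hA : ∀ k i j, 0 ≤ A k i j) (k : Fin m) (w : List (Fin m)) (i u j : Fin n) :
    A k i u * wordProd A w u j ≤ wordProd A (k :: w) i j := by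
  cases w with
  | nil =>
    by_cases huj : u = j
    · simp [wordProd, huj]
    · simpa [wordProd, huj] using hA k i j
  | cons k' w =>
    exact le_ciSup (f := fun u => A k i u * wordProd A (k' :: w) u j)
      (Set.finite_range _).bddAbove u

/-- The largest maximal cycle geometric mean over all words of length `p`. -/
noncomputable def wordMu (A : Fin m → Fin n → Fin n → ℝ) (p : ℕ) : ℝ :=
  sSup {c | ∃ w : List (Fin m), w.length = p ∧ c = mu (wordProd A w)}

theorem genSpecRad_eq (A : Fin m → Fin n → Fin n → ℝ) :
    genSpecRad A = limsup (fun p : ℕ => wordMu A p ^ ((p : ℝ)⁻¹)) atTop := rfl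

theorem wordMu_nonneg {A : Fin m → Fin n → Fin n → ℝ} (hA : ∀ k i j, 0 ≤ A k i j) (p : ℕ) :
    0 ≤ wordMu A p := by
  refine Real.sSup_nonneg ?_
  rintro _ ⟨w, -, rfl⟩
  exact mu_nonneg_s14 (wordProd_nonneg hA w)

theorem wordMu_le {A : Fin m → Fin n → Fin n → ℝ} {x : Fin n → ℝ} {r : ℝ} (hr : 0 ≤ r)
    (hA : ∀ k i j, 0 ≤ A k i j) (hx : ∀ i, 0 < x i)
    (h : ∀ k i j, A k i j * x j ≤ r * x i) (p : ℕ) : wordMu A p ≤ r ^ p := by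
  refine Real.sSup_le ?_ (by positivity)
  rintro _ ⟨w, rfl, rfl⟩
  exact mu_le (by positivity) (wordProd_nonneg hA w) hx (wordProd_mul_le hr hA hx h w)

theorem wordProd_diag_le_wordMu {A : Fin m → Fin n → Fin n → ℝ} {x : Fin n → ℝ} {r : ℝ}
    (hr : 0 ≤ r) (hA : ∀ k i j, 0 ≤ A k i j) (hx : ∀ i, 0 < x i)
    (h : ∀ k i j, A k i j * x j ≤ r * x i) (w : List (Fin m)) (i : Fin n) :
    wordProd A w i i ≤ wordMu A w.length := by
  refine (diag_le_mu (by positivity) (wordProd_nonneg hA w) hx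
    (wordProd_mul_le hr hA hx h w) i).trans (le_csSup ⟨r ^ w.length, ?_⟩ ⟨w, rfl, rfl⟩)
  rintro _ ⟨w', hw', rfl⟩
  rw [← hw']
  exact mu_le (by positivity) (wordProd_nonneg hA w') hx (wordProd_mul_le hr hA hx h w')

theorem eventually_wordMu_rpow_le {A : Fin m → Fin n → Fin n → ℝ} {x : Fin n → ℝ} {r : ℝ}
    (hr : 0 ≤ r) (hA : ∀ k i j, 0 ≤ A k i j) (hx : ∀ i, 0 < x i)
    (h : ∀ k i j, A k i j * x j ≤ r * x i) :
    ∀ᶠ p : ℕ in atTop, wordMu A p ^ ((p : ℝ)⁻¹) ≤ r := by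
  filter_upwards [eventually_ne_atTop 0] with p hp
  calc wordMu A p ^ ((p : ℝ)⁻¹) ≤ (r ^ p) ^ ((p : ℝ)⁻¹) :=
        Real.rpow_le_rpow (wordMu_nonneg hA p) (wordMu_le hr hA hx h p) (by positivity)
    _ = r := Real.pow_rpow_inv_natCast hr hp

theorem genSpecRad_le {A : Fin m → Fin n → Fin n → ℝ} {x : Fin n → ℝ} {r : ℝ}
    (hr : 0 ≤ r) (hA : ∀ k i j, 0 ≤ A k i j) (hx : ∀ i, 0 < x i)
    (h : ∀ k i j, A k i j * x j ≤ r * x i) : genSpecRad A ≤ r := by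
  rw [genSpecRad_eq]
  refine limsup_le_of_le ?_ (eventually_wordMu_rpow_le hr hA hx h)
  exact IsBoundedUnder.isCoboundedUnder_le
    ⟨0, eventually_map.2 (Eventually.of_forall fun p => Real.rpow_nonneg (wordMu_nonneg hA p) _)⟩

end EntrywiseBounds

section Walks

variable {n m : ℕ}

/-- The endpoint of the walk that starts at `i` and follows the labelled steps of the list. -/
def walkEnd (i : Fin n) : List (Fin m × Fin n) → Fin n
  | [] => i
  | e :: l => walkEnd e.2 l

/-- The weight of the walk that starts at `i`, a step `(k, j)` using the matrix `A k` to move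
to the node `j`. -/
def walkWeight (A : Fin m → Fin n → Fin n → ℝ) (i : Fin n) : List (Fin m × Fin n) → ℝ
  | [] => 1
  | e :: l => A e.1 i e.2 * walkWeight A e.2 l

theorem walkEnd_append (i : Fin n) (l l' : List (Fin m × Fin n)) :
    walkEnd i (l ++ l') = walkEnd (walkEnd i l) l' := by
  induction l generalizing i with
  | nil => rfl
  | cons e l ih => exact ih e.2

theorem walkWeight_append (A : Fin m → Fin n → Fin n → ℝ) (i : Fin n)
    (l l' : List (Fin m × Fin n)) :
    walkWeight A i (l ++ l') = walkWeight A i l * walkWeight A (walkEnd i l) l' := by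
  induction l generalizing i with
  | nil => simp [walkWeight, walkEnd]
  | cons e l ih => simp [walkWeight, walkEnd, ih, mul_assoc]

theorem walkWeight_nonneg {A : Fin m → Fin n → Fin n → ℝ} (hA : ∀ k i j, 0 ≤ A k i j)
    (i : Fin n) (l : List (Fin m × Fin n)) : 0 ≤ walkWeight A i l := by
  induction l generalizing i with
  | nil => exact zero_le_one
  | cons e l ih => exact mul_nonneg (hA _ _ _) (ih _)

theorem walkWeight_le_wordProd {A : Fin m → Fin n → Fin n → ℝ} (hA : ∀ k i j, 0 ≤ A k i j)
    (i : Fin n) (l : List (Fin m × Fin n)) :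
    walkWeight A i l ≤ wordProd A (l.map Prod.fst) i (walkEnd i l) := by
  induction l generalizing i with
  | nil => simp [walkWeight, walkEnd, wordProd]
  | cons e l ih =>
    exact (mul_le_mul_of_nonneg_left (ih e.2) (hA _ _ _)).trans
      (mul_wordProd_le_wordProd_cons hA _ _ _ _ _)

theorem walkWeight_div (A : Fin m → Fin n → Fin n → ℝ) (r : ℝ) (i : Fin n)
    (l : List (Fin m × Fin n)) :
    walkWeight (fun k i j => A k i j / r) i l = walkWeight A i l / r ^ l.length := by
  induction l generalizing i with
  | nil => simp [walkWeight]
  | cons e l ih => simp [walkWeight, ih, div_mul_div_comm, pow_succ']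

theorem exists_closed_walk_power (A : Fin m → Fin n → Fin n → ℝ) {i : Fin n}
    {l : List (Fin m × Fin n)} (hl : walkEnd i l = i) (t : ℕ) :
    ∃ l' : List (Fin m × Fin n), walkEnd i l' = i ∧ l'.length = l.length * t ∧
      walkWeight A i l' = walkWeight A i l ^ t := by
  induction t with
  | zero => exact ⟨[], rfl, rfl, by simp [walkWeight]⟩
  | succ t ih =>
    obtain ⟨l', hend, hlen, hw⟩ := ih
    refine ⟨l ++ l', ?_, ?_, ?_⟩
    · rw [walkEnd_append, hl, hend]
    · rw [List.length_append, hlen]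
      ring
    · rw [walkWeight_append, hl, hw, pow_succ']

theorem exists_entry_bound (A : Fin m → Fin n → Fin n → ℝ) :
    ∃ M : ℝ, 1 ≤ M ∧ ∀ k i j, A k i j ≤ M := by
  obtain ⟨M, hM⟩ := (Set.finite_range fun p : Fin m × Fin n × Fin n =>
    A p.1 p.2.1 p.2.2).bddAbove
  exact ⟨max 1 M, le_max_left _ _, fun k i j =>
    (hM ⟨(k, i, j), rfl⟩).trans (le_max_right _ _)⟩

theorem closed_walkWeight_le {A : Fin m → Fin n → Fin n → ℝ} (hA : ∀ k i j, 0 ≤ A k i j)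
    {i : Fin n} {l : List (Fin m × Fin n)} (hl : walkEnd i l = i) :
    walkWeight A i l ≤ genSpecRad A ^ l.length := by
  obtain rfl | hne := eq_or_ne l []
  · simp [walkWeight]
  have hlen : l.length ≠ 0 := by simpa using hne
  obtain ⟨M, hM1, hM⟩ := exists_entry_bound A
  have hM0 : 0 ≤ M := zero_le_one.trans hM1
  have hone : ∀ i : Fin n, (0 : ℝ) < (fun _ => 1) i := fun _ => one_pos
  have hbound : ∀ k i j, A k i j * (fun _ : Fin n => (1 : ℝ)) j ≤
      M * (fun _ : Fin n => (1 : ℝ)) i := by simpa using hM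
  have hw := walkWeight_nonneg hA i l
  have hroot : walkWeight A i l ^ ((l.length : ℝ)⁻¹) ≤ genSpecRad A := by
    rw [genSpecRad_eq]
    refine le_limsup_of_frequently_le ?_
      ⟨M, eventually_map.2 (eventually_wordMu_rpow_le hM0 hA hone hbound)⟩
    refine frequently_atTop.2 fun N => ⟨l.length * (N + 1), ?_, ?_⟩
    · nlinarith [Nat.pos_of_ne_zero hlen]
    obtain ⟨l', hend, hlen', hw'⟩ := exists_closed_walk_power A hl (N + 1)
    have hle : walkWeight A i l ^ (N + 1) ≤ wordMu A (l.length * (N + 1)) := by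
      have h1 := walkWeight_le_wordProd hA i l'
      have h2 := wordProd_diag_le_wordMu hM0 hA hone hbound (l'.map Prod.fst) i
      rw [hend] at h1
      rw [List.length_map, hlen'] at h2
      exact hw' ▸ h1.trans h2
    calc walkWeight A i l ^ ((l.length : ℝ)⁻¹)
        = (walkWeight A i l ^ (N + 1)) ^ (((l.length * (N + 1) : ℕ) : ℝ)⁻¹) := by
          rw [← Real.rpow_natCast, ← Real.rpow_mul hw]
          congr 1
          have : (l.length : ℝ) ≠ 0 := by exact_mod_cast hlen
          push_cast
          field_simp
      _ ≤ _ := Real.rpow_le_rpow (by positivity) hle (by positivity)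
  calc walkWeight A i l = (walkWeight A i l ^ ((l.length : ℝ)⁻¹)) ^ l.length :=
        (Real.rpow_inv_natCast_pow hw hlen).symm
    _ ≤ _ := pow_le_pow_left₀ (Real.rpow_nonneg hw _) hroot _

/-- If no closed walk has weight above one, then a walk whose nodes lie in `V` has weight at most
`M ^ |V|`. -/
theorem walkWeight_le_pow_card {B : Fin m → Fin n → Fin n → ℝ} {M : ℝ}
    (hB : ∀ k i j, 0 ≤ B k i j) (hM1 : 1 ≤ M) (hM : ∀ k i j, B k i j ≤ M)
    (hclosed : ∀ i l, walkEnd i l = i → walkWeight B i l ≤ 1) (i : Fin n)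
    (l : List (Fin m × Fin n)) (V : Finset (Fin n)) (hi : i ∈ V) (hV : ∀ e ∈ l, e.2 ∈ V) :
    walkWeight B i l ≤ M ^ V.card := by
  by_cases hmem : ∃ e ∈ l, e.2 = i
  · obtain ⟨e, he, hei⟩ := hmem
    obtain ⟨l₁, l₂, rfl⟩ := List.append_of_mem he
    have hend : walkEnd i (l₁ ++ [e]) = i := by rw [walkEnd_append]; exact hei
    have ih := walkWeight_le_pow_card hB hM1 hM hclosed i l₂ V hi
      fun e' he' => hV e' (by simp [he'])
    have hsplit : l₁ ++ e :: l₂ = (l₁ ++ [e]) ++ l₂ := by simp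
    rw [hsplit, walkWeight_append, hend]
    exact (mul_le_of_le_one_left (walkWeight_nonneg hB _ _) (hclosed _ _ hend)).trans ih
  · push Not at hmem
    cases l with
    | nil => exact one_le_pow₀ hM1
    | cons e l =>
      have ih := walkWeight_le_pow_card hB hM1 hM hclosed e.2 l (V.erase i)
        (Finset.mem_erase.2 ⟨hmem e (by simp), hV e (by simp)⟩)
        fun e' he' => Finset.mem_erase.2 ⟨hmem e' (by simp [he']), hV e' (by simp [he'])⟩
      rw [← Finset.card_erase_add_one hi, pow_succ']
      exact mul_le_mul (hM _ _ _) ih (walkWeight_nonneg hB _ _) (zero_le_one.trans hM1)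
termination_by l.length

theorem exists_subeigenvector {B : Fin m → Fin n → Fin n → ℝ} (hB : ∀ k i j, 0 ≤ B k i j)
    (hclosed : ∀ i l, walkEnd i l = i → walkWeight B i l ≤ 1) :
    ∃ x : Fin n → ℝ, (∀ i, 0 < x i) ∧ ∀ k i j, B k i j * x j ≤ x i := by
  obtain ⟨M, hM1, hM⟩ := exists_entry_bound B
  have hbdd : ∀ i, BddAbove (Set.range (walkWeight B i)) := by
    refine fun i => ⟨M ^ (Finset.univ : Finset (Fin n)).card, ?_⟩
    rintro _ ⟨l, rfl⟩
    exact walkWeight_le_pow_card hB hM1 hM hclosed i l _ (Finset.mem_univ _)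
      fun _ _ => Finset.mem_univ _
  refine ⟨fun i => ⨆ l, walkWeight B i l, fun i => ?_, fun k i j => ?_⟩
  · exact zero_lt_one.trans_le (le_ciSup (hbdd i) [])
  · rw [Real.mul_iSup_of_nonneg (hB k i j)]
    exact ciSup_le fun l => le_ciSup (hbdd i) ((k, j) :: l)

end Walks

theorem iSup_errF_nonneg {n m : ℕ} {A : Fin m → Fin n → Fin n → ℝ} {x : Fin n → ℝ}
    (hA : ∀ k i j, 0 ≤ A k i j) (hx : ∀ i, 0 < x i) : 0 ≤ ⨆ k, errF (A k) x :=
  Real.iSup_nonneg fun k => Real.iSup_nonneg fun i => Real.iSup_nonneg fun j =>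
    div_nonneg (mul_nonneg (hA k i j) (hx j).le) (hx i).le

theorem iSup_errF_le_iff {n m : ℕ} {A : Fin m → Fin n → Fin n → ℝ} {x : Fin n → ℝ} {r : ℝ}
    (hr : 0 ≤ r) (hx : ∀ i, 0 < x i) :
    (⨆ k, errF (A k) x) ≤ r ↔ ∀ k i j, A k i j * x j ≤ r * x i := by
  refine ⟨fun h k i j => ?_, fun h => Real.iSup_le (fun k => Real.iSup_le (fun i =>
    Real.iSup_le (fun j => (div_le_iff₀ (hx i)).2 (h k i j)) hr) hr) hr⟩
  rw [← div_le_iff₀ (hx i)]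
  calc A k i j * x j / x i ≤ ⨆ j, A k i j * x j / x i :=
        le_ciSup (f := fun j => A k i j * x j / x i) (Set.finite_range _).bddAbove j
    _ ≤ errF (A k) x :=
        le_ciSup (f := fun i => ⨆ j, A k i j * x j / x i) (Set.finite_range _).bddAbove i
    _ ≤ ⨆ k, errF (A k) x :=
        le_ciSup (f := fun k => errF (A k) x) (Set.finite_range _).bddAbove k
    _ ≤ r := h

theorem mem_iInter_Cset_iff {n m : ℕ} {A : Fin m → Fin n → Fin n → ℝ} {x : Fin n → ℝ} {r : ℝ}
    (hr : 0 ≤ r) (hx : ∀ i, 0 < x i) :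
    x ∈ ⋂ k, Cset (A k) r ↔ ∀ k i j, A k i j * x j ≤ r * x i := by
  rw [Set.mem_iInter]
  refine ⟨fun h k i j => ?_, fun h k => ⟨hx, fun i =>
    Real.iSup_le (fun j => h k i j) (mul_nonneg hr (hx i).le)⟩⟩
  exact (le_ciSup (f := fun j => A k i j * x j) (Set.finite_range _).bddAbove j).trans ((h k).2 i)

/-- `min_{x > 0} max_i e_{A_i}(x)` is attained and equals `μ̂(Ψ)`, and the
minimisers are exactly the elements of `C_Ψ = C_{Ψ,μ̂(Ψ)}`. -/
theorem stmt14 {n m : ℕ} (hm : 0 < m) (A : Fin m → Fin n → Fin n → ℝ)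
    (hA : ∀ k i j, 0 ≤ A k i j) (h0 : ∃ k, A k ≠ 0) (hmu : 0 < genSpecRad A) :
    (∀ x : Fin n → ℝ, (∀ i, 0 < x i) → genSpecRad A ≤ ⨆ k, errF (A k) x) ∧
    (∃ x : Fin n → ℝ, (∀ i, 0 < x i) ∧ (⨆ k, errF (A k) x) = genSpecRad A) ∧
    (∀ x : Fin n → ℝ, (∀ i, 0 < x i) →
      ((⨆ k, errF (A k) x) = genSpecRad A ↔
        x ∈ ⋂ k, Cset (A k) (genSpecRad A))) := by
  have hlow : ∀ x : Fin n → ℝ, (∀ i, 0 < x i) → genSpecRad A ≤ ⨆ k, errF (A k) x :=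
    fun x hx => genSpecRad_le (iSup_errF_nonneg hA hx) hA hx
      ((iSup_errF_le_iff (iSup_errF_nonneg hA hx) hx).1 le_rfl)
  refine ⟨hlow, ?_, fun x hx => ?_⟩
  · obtain ⟨x, hx, h⟩ := exists_subeigenvector
      (B := fun k i j => A k i j / genSpecRad A) (fun k i j => div_nonneg (hA k i j) hmu.le)
      fun i l hl => by
        rw [walkWeight_div]
        exact div_le_one_of_le₀ (closed_walkWeight_le hA hl) (by positivity)
    refine ⟨x, hx, le_antisymm ((iSup_errF_le_iff hmu.le hx).2 fun k i j => ?_) (hlow x hx)⟩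
    have hkij := h k i j
    rwa [div_mul_eq_mul_div, div_le_iff₀' hmu] at hkij
  · rw [mem_iInter_Cset_iff hmu.le hx, ← iSup_errF_le_iff hmu.le hx]
    exact ⟨le_of_eq, fun h => le_antisymm h (hlow x hx)⟩

end MaxAlg
end

section
/- Let Ψ = {A_1, …, A_m} be a finite set of nonnegative n×n matrices, at least one of which is nonzero. (i) If w ∈ C_Ψ and C_Ψ = {αw : α > 0} (w is unique in C_Ψ up to scalar multiples), then w is a Pareto optimal point for e_{A_1}, …, e_{A_m}. (ii) If for some index i, w ∈ C_{A_i} and C_{A_i} = {αw : α > 0}, then w is a Pareto optimal point for e_{A_1}, …, e_{A_m}. -/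
open Filter Relation

namespace MaxAlg

/-- Membership in `C_{A,r}` is the bound `e_A(x) ≤ r`. -/
theorem mem_Cset_iff_errF_le {n : ℕ} [Nonempty (Fin n)] (A : Fin n → Fin n → ℝ) (r : ℝ)
    {x : Fin n → ℝ} (hx : ∀ i, 0 < x i) : x ∈ Cset A r ↔ errF A x ≤ r := by
  have hbdd : ∀ f : Fin n → ℝ, BddAbove (Set.range f) := fun f => (Set.finite_range f).bddAbove
  simp only [Cset, Set.mem_ofPred_eq, maxVec, errF, ciSup_le_iff (hbdd _), div_le_iff₀ (hx _)]
  exact and_iff_right hx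

theorem errF_smul {n : ℕ} (A : Fin n → Fin n → ℝ) {a : ℝ} (ha : a ≠ 0) (x : Fin n → ℝ) :
    errF A (a • x) = errF A x := by
  simp only [errF, Pi.smul_apply, smul_eq_mul, mul_left_comm _ a, mul_div_mul_left _ _ ha]

/-- (i) if `w` spans `C_Ψ` (uniqueness up to scalar multiples) then `w`
is Pareto optimal; (ii) if for some index `t`, `w` spans `C_{A_t}` then `w` is Pareto
optimal for `e_{A_1}, …, e_{A_m}`. -/
theorem stmt16 {n m : ℕ} (hm : 0 < m) (A : Fin m → Fin n → Fin n → ℝ)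
    (hA : ∀ k i j, 0 ≤ A k i j) (h0 : ∃ k, A k ≠ 0) :
    (∀ w : Fin n → ℝ, w ∈ (⋂ k, Cset (A k) (genSpecRad A)) →
      (⋂ k, Cset (A k) (genSpecRad A)) = {y | ∃ α : ℝ, 0 < α ∧ y = α • w} →
      ∀ x : Fin n → ℝ, (∀ i, 0 < x i) →
        (∀ k, errF (A k) x ≤ errF (A k) w) → ∀ k, errF (A k) x = errF (A k) w) ∧
    (∀ t, ∀ w : Fin n → ℝ, w ∈ Cset (A t) (mu (A t)) →
      Cset (A t) (mu (A t)) = {y | ∃ α : ℝ, 0 < α ∧ y = α • w} →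
      ∀ x : Fin n → ℝ, (∀ i, 0 < x i) →
        (∀ k, errF (A k) x ≤ errF (A k) w) → ∀ k, errF (A k) x = errF (A k) w) := by
  have : Nonempty (Fin n) := by
    obtain ⟨k, hk⟩ := h0
    obtain ⟨i, -⟩ := Function.ne_iff.mp hk
    exact ⟨i⟩
  refine ⟨fun w hw huniq x hx hle k => ?_, fun t w hw huniq x hx hle k => ?_⟩
  · have hxC : x ∈ ⋂ k, Cset (A k) (genSpecRad A) := Set.mem_iInter.mpr fun l =>
      have hwl := Set.mem_iInter.mp hw l
      (mem_Cset_iff_errF_le _ _ hx).mpr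
        ((hle l).trans ((mem_Cset_iff_errF_le _ _ hwl.1).mp hwl))
    rw [huniq] at hxC
    obtain ⟨a, ha, rfl⟩ := hxC
    exact errF_smul _ ha.ne' w
  · have hxC : x ∈ Cset (A t) (mu (A t)) :=
      (mem_Cset_iff_errF_le _ _ hx).mpr
        ((hle t).trans ((mem_Cset_iff_errF_le _ _ hw.1).mp hw))
    rw [huniq] at hxC
    obtain ⟨a, ha, rfl⟩ := hxC
    exact errF_smul _ ha.ne' w

end MaxAlg
end

section
/- Let Ψ = {A_1, …, A_m} be a finite set of n×n SR-matrices and let w ∈ D_Ψ be Pareto optimal for e_{A_1}, …, e_{A_m} with respect to D_Ψ (i.e. for every x ∈ D_Ψ, if e_{A_i}(x) ≤ e_{A_i}(w) for all i then e_{A_i}(x) = e_{A_i}(w) for all i). Then w is Pareto optimal with respect to int(ℝ^n_+): for every x ∈ int(ℝ^n_+), if e_{A_i}(x) ≤ e_{A_i}(w) for all i then e_{A_i}(x) = e_{A_i}(w) for all i. -/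
open Filter Relation

namespace MaxAlg

theorem errF_le_iff {n : ℕ} [NeZero n] {A : Fin n → Fin n → ℝ} {x : Fin n → ℝ}
    (hx : ∀ i, 0 < x i) {r : ℝ} : errF A x ≤ r ↔ ∀ i, maxVec A x i ≤ r * x i := by
  simp only [errF, maxVec, ciSup_le_iff (Set.finite_range _).bddAbove, div_le_iff₀ (hx _)]

theorem errF_div {n : ℕ} (A : Fin n → Fin n → ℝ) (x : Fin n → ℝ) {c : ℝ} (hc : c ≠ 0) :
    errF A (fun i => x i / c) = errF A x := by
  simp only [errF, ← mul_div_assoc, div_div_div_cancel_right₀ hc]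

/-- a point of `D_Ψ` that is Pareto optimal with respect to `D_Ψ` is also
Pareto optimal with respect to all positive vectors. -/
theorem stmt18 {n m : ℕ} (hm : 0 < m) (A : Fin m → Fin (n + 1) → Fin (n + 1) → ℝ)
    (hSR : ∀ k, IsSR (A k)) (w : Fin (n + 1) → ℝ)
    (hw : w ∈ {x ∈ ⋂ k, Cset (A k) (genSpecRad A) | x 0 = 1})
    (hpar : ∀ x ∈ {x ∈ ⋂ k, Cset (A k) (genSpecRad A) | x 0 = 1},
      (∀ k, errF (A k) x ≤ errF (A k) w) → ∀ k, errF (A k) x = errF (A k) w) :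
    ∀ x : Fin (n + 1) → ℝ, (∀ i, 0 < x i) →
      (∀ k, errF (A k) x ≤ errF (A k) w) → ∀ k, errF (A k) x = errF (A k) w := by
  intro x hx hle
  have hpos : ∀ i, 0 < x i / x 0 := fun i => div_pos (hx i) (hx 0)
  have herr : ∀ k, errF (A k) (fun i => x i / x 0) = errF (A k) x :=
    fun k => errF_div (A k) x (hx 0).ne'
  have hmem : (fun i => x i / x 0) ∈ {x ∈ ⋂ k, Cset (A k) (genSpecRad A) | x 0 = 1} := by
    refine ⟨Set.mem_iInter.2 fun k => ⟨hpos, (errF_le_iff hpos).1 ?_⟩, div_self (hx 0).ne'⟩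
    have hwk := Set.mem_iInter.1 hw.1 k
    exact (herr k).le.trans ((hle k).trans ((errF_le_iff hwk.1).2 hwk.2))
  simpa only [herr] using hpar _ hmem (by simpa only [herr] using hle)

end MaxAlg
end
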